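/- (Cut-and-pile majorisation.) Let d ≥ 2, let η be the uniform distribution on d outcomes, and let p, q ∈ ℝ^d be probability distributions with D(p‖η) > 0, D(q‖η) > 0, V(p‖η) > 0, V(q‖η) > 0. Let (t_n) be a moderate sequence, fix μ ≠ 0, set r_n(μ) = (D(p‖η) + μ t_n)/D(q‖η), m_n = ⌊n·r_n(μ)⌋, P^n = (p^{⊗n} ⊗ η^{⊗m_n})^↓, Q^n = (q^{⊗m_n} ⊗ η^{⊗n})^↓, K_n(x) = exp( H(Q^n) + x·n·t_n ), and ν = (V(p‖η)/D(p‖η)) / (V(q‖η)/D(q‖η)); assume ν ≠ 1 if μ < 0. Define z_C = μ/(1 − √ν), z_T = μ/(1 + √ν), and z_{μ,ν} = 2μ − z_C if μ < 0 and ν < 1, z_{μ,ν} = z_C if μ < 0 and ν > 1, z_{μ,ν} = z_T if μ > 0. For sufficiently small ζ > 0, with y = z_{μ,ν} − ζ, define the cut-and-pile vector P̃^{(μ)} by: P̃^{(μ)}_1 = P^n_1 + ∑_{i ≥ K_n(y)} P^n_i; P̃^{(μ)}_i = P^n_i for 1 < i < K_n(y); and P̃^{(μ)}_i = 0 for i ≥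 K_n(y). Then there exists N such that for all n ≥ N, P̃^{(μ)} ≻ Q^n. -/

import Mathlib

open Finset Filter Real Topology

noncomputable section

/-- A probability distribution on a finite type: nonnegative entries summing to 1. -/
def IsProbDist {α : Type*} [Fintype α] (a : α → ℝ) : Prop :=
  (∀ i, 0 ≤ a i) ∧ ∑ i, a i = 1

/-- A sharp distribution: a single entry equal to 1, all others 0. -/
def IsSharp {α : Type*} [Fintype α] (a : α → ℝ) : Prop :=
  ∃ i, a i = 1 ∧ ∀ j, j ≠ i → a j = 0

/-- The uniform distribution: all entries equal to `1 / |α|`. -/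
def IsUniform {α : Type*} [Fintype α] (a : α → ℝ) : Prop :=
  ∀ i, a i = 1 / (Fintype.card α : ℝ)

/-- Tensor (Kronecker) product of two vectors. -/
def tensor {α β : Type*} (a : α → ℝ) (b : β → ℝ) : α × β → ℝ :=
  fun x => a x.1 * b x.2

/-- `n`-fold tensor power of a vector. -/
def tpow {α : Type*} (a : α → ℝ) (n : ℕ) : (Fin n → α) → ℝ :=
  fun f => ∏ j, a (f j)

/-- Shannon entropy (natural logarithm, with the convention `0 · ln 0 = 0`). -/
def shannonH {α : Type*} [Fintype α] (a : α → ℝ) : ℝ :=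
  -∑ i, a i * Real.log (a i)

/-- Entropy variance `V(a) = ∑ i, a i (ln a i + H(a))²`. -/
def entV {α : Type*} [Fintype α] (a : α → ℝ) : ℝ :=
  ∑ i, a i * (Real.log (a i) + shannonH a) ^ 2

/-- Relative entropy `D(a‖b)`. -/
def relD {α : Type*} [Fintype α] (a b : α → ℝ) : ℝ :=
  ∑ i, a i * Real.log (a i / b i)

/-- Relative entropy variance `V(a‖b)`. -/
def relV {α : Type*} [Fintype α] (a b : α → ℝ) : ℝ :=
  ∑ i, a i * (Real.log (a i / b i) - relD a b) ^ 2

/-- Total variation distance. -/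
def tvd {α : Type*} [Fintype α] (a b : α → ℝ) : ℝ :=
  (1 / 2) * ∑ i, |a i - b i|

/-- Fidelity `F(a,b) = (∑ i √(a i · b i))²`. -/
def fid {α : Type*} [Fintype α] (a b : α → ℝ) : ℝ :=
  (∑ i, Real.sqrt (a i * b i)) ^ 2

/-- The entries of `a` sorted in non-increasing order, as a vector on `Fin (card α)`. -/
def descSorted {α : Type*} [Fintype α] (a : α → ℝ) : Fin (Fintype.card α) → ℝ :=
  fun i =>
    a ((Fintype.equivFin α).symm
      (Tuple.sort (fun j => -a ((Fintype.equivFin α).symm j)) i))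

/-- `headSum a K = ∑_{1 ≤ i ≤ K} a^↓_i` (1-based indices `i`, comparison `(i : ℝ) ≤ K`,
equivalently `i ≤ ⌊K⌋`). -/
def headSum {α : Type*} [Fintype α] (a : α → ℝ) (K : ℝ) : ℝ :=
  ∑ i ∈ Finset.univ.filter (fun i : Fin (Fintype.card α) => ((i : ℕ) + 1 : ℝ) ≤ K),
    descSorted a i

/-- `tailSum a K = ∑_{i ≥ K} a^↓_i` (1-based indices `i`, comparison `K ≤ (i : ℝ)`,
equivalently `i ≥ ⌈K⌉`). -/
def tailSum {α : Type*} [Fintype α] (a : α → ℝ) (K : ℝ) : ℝ :=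
  ∑ i ∈ Finset.univ.filter (fun i : Fin (Fintype.card α) => K ≤ ((i : ℕ) + 1 : ℝ)),
    descSorted a i

/-- `a` majorises `b` (written `a ≻ b`): every partial sum of the non-increasingly sorted
`a` dominates the corresponding partial sum of sorted `b` (shorter vectors padded with zeros). -/
def Maj {α β : Type*} [Fintype α] [Fintype β] (a : α → ℝ) (b : β → ℝ) : Prop :=
  ∀ j : ℕ, headSum b (j : ℝ) ≤ headSum a (j : ℝ)

/-- `a ≻_ε b`: approximate majorisation (from above) with total variation error:
there is a probability distribution `b̃` with `a ≻ b̃` and `δ(b, b̃) ≤ ε`. -/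
def ApproxMajTV {α β : Type*} [Fintype α] [Fintype β] (a : α → ℝ) (b : β → ℝ) (ε : ℝ) : Prop :=
  ∃ bt : β → ℝ, IsProbDist bt ∧ Maj a bt ∧ tvd b bt ≤ ε

/-- `a ≺_ε b`: approximate majorisation (from below) with total variation error:
there is a probability distribution `b̃` with `a ≺ b̃` and `δ(b, b̃) ≤ ε`. -/
def ApproxSubMajTV {α β : Type*} [Fintype α] [Fintype β] (a : α → ℝ) (b : β → ℝ) (ε : ℝ) : Prop :=
  ∃ bt : β → ℝ, IsProbDist bt ∧ Maj bt a ∧ tvd b bt ≤ ε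

/-- A moderate sequence: `t n → 0` and `√n · t n → +∞`. -/
def ModerateSeq (t : ℕ → ℝ) : Prop :=
  Tendsto t atTop (𝓝 0) ∧ Tendsto (fun n : ℕ => Real.sqrt (n : ℝ) * t n) atTop atTop

/-- The uniform distribution on `Fin d`. -/
def unif (d : ℕ) : Fin d → ℝ := fun _ => 1 / (d : ℝ)

/-- The embedding map `Γ` associated with `γ_i = c_i / N`: for each `i` it produces
`c_i` entries equal to `a_i / c_i`. -/
def embed {d : ℕ} (c : Fin d → ℕ) (a : Fin d → ℝ) : (Σ i : Fin d, Fin (c i)) → ℝ :=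
  fun x => a x.1 / (c x.1 : ℝ)

/-- Cut-and-pile modification of the sorted version of `a`, with cut at `K`:
the first entry absorbs the total mass of entries at (1-based) positions `≥ K`,
entries at positions `1 < i < K` are unchanged, and entries at positions `≥ K` are set to 0. -/
def cutAndPile {α : Type*} [Fintype α] (a : α → ℝ) (K : ℝ) : Fin (Fintype.card α) → ℝ :=
  fun i =>
    if (i : ℕ) = 0 then descSorted a i + tailSum a K
    else if ((i : ℕ) + 1 : ℝ) < K then descSorted a i else 0

section Sorting

variable {α : Type*} [Fintype α]

/-- The reindexing that sorts `a` in non-increasing order. -/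
def descEquiv (a : α → ℝ) : Fin (Fintype.card α) ≃ α :=
  (Tuple.sort fun j => -a ((Fintype.equivFin α).symm j)).trans (Fintype.equivFin α).symm

lemma descSorted_apply (a : α → ℝ) (i : Fin (Fintype.card α)) :
    descSorted a i = a (descEquiv a i) := rfl

lemma descSorted_antitone (a : α → ℝ) : Antitone (descSorted a) := fun i j hij => by
  have := Tuple.monotone_sort (fun j => -a ((Fintype.equivFin α).symm j)) hij
  simpa [descSorted] using this

lemma descSorted_nonneg {a : α → ℝ} (ha : ∀ i, 0 ≤ a i) (i : Fin (Fintype.card α)) :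
    0 ≤ descSorted a i := ha _

lemma sum_descSorted (a : α → ℝ) : ∑ i, descSorted a i = ∑ i, a i :=
  Equiv.sum_comp (descEquiv a) a

lemma headSum_mono {a : α → ℝ} (ha : ∀ i, 0 ≤ a i) {K K' : ℝ} (h : K ≤ K') :
    headSum a K ≤ headSum a K' :=
  Finset.sum_le_sum_of_subset_of_nonneg
    (Finset.monotone_filter_right _ fun _ _ hi => le_trans hi h)
    fun i _ _ => descSorted_nonneg ha i

lemma headSum_nonneg {a : α → ℝ} (ha : ∀ i, 0 ≤ a i) (K : ℝ) : 0 ≤ headSum a K :=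
  Finset.sum_nonneg fun i _ => descSorted_nonneg ha i

lemma headSum_le_one {a : α → ℝ} (ha : IsProbDist a) (K : ℝ) : headSum a K ≤ 1 := by
  rw [← ha.2, ← sum_descSorted]
  exact Finset.sum_le_sum_of_subset_of_nonneg (Finset.subset_univ _)
    fun i _ _ => descSorted_nonneg ha.1 i

lemma one_le_headSum_add_tailSum {a : α → ℝ} (ha : IsProbDist a) (K : ℝ) :
    1 ≤ headSum a K + tailSum a K := by
  rw [← ha.2, ← sum_descSorted, headSum, tailSum, Finset.sum_filter, Finset.sum_filter,
    ← Finset.sum_add_distrib]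
  refine Finset.sum_le_sum fun i _ => ?_
  have := descSorted_nonneg ha.1 i
  rcases le_total ((i : ℕ) + 1 : ℝ) K with h | h
  · rw [if_pos h]; split_ifs <;> linarith
  · rw [if_pos h]; split_ifs <;> linarith

lemma card_filter_succ_le (N : ℕ) {K : ℝ} (hK : 0 ≤ K) :
    (((Finset.univ.filter fun i : Fin N => ((i : ℕ) + 1 : ℝ) ≤ K).card : ℕ) : ℝ) ≤ K := by
  refine le_trans ?_ (Nat.floor_le hK)
  have : ((Finset.univ.filter fun i : Fin N => ((i : ℕ) + 1 : ℝ) ≤ K).map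
      Fin.valEmbedding) ⊆ Finset.range ⌊K⌋₊ := by
    intro k hk
    simp only [Finset.mem_map, Finset.mem_filter, Finset.mem_univ, true_and] at hk
    obtain ⟨i, hi, rfl⟩ := hk
    rw [Finset.mem_range]
    exact Nat.le_floor (by simpa using hi)
  simpa using Finset.card_le_card this

lemma le_card_filter_succ {N c : ℕ} (hc : c ≤ N) {K : ℝ} (hK : (c : ℝ) ≤ K) :
    c ≤ (Finset.univ.filter fun i : Fin N => ((i : ℕ) + 1 : ℝ) ≤ K).card := by
  have : (Finset.univ.map (Fin.castLEEmb hc)) ⊆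
      Finset.univ.filter fun i : Fin N => ((i : ℕ) + 1 : ℝ) ≤ K := by
    intro k hk
    simp only [Finset.mem_map, Finset.mem_univ, true_and] at hk
    obtain ⟨i, rfl⟩ := hk
    simp only [Finset.mem_filter, Finset.mem_univ, true_and]
    refine le_trans ?_ hK
    exact_mod_cast i.2
  simpa using Finset.card_le_card this

lemma sum_le_sum_of_threshold {ι : Type*} [DecidableEq ι] {s : ι → ℝ} {T F : Finset ι} {τ : ℝ}
    (hτ : 0 ≤ τ) (hcard : T.card ≤ F.card) (hF : ∀ i ∈ F, τ ≤ s i) (hF' : ∀ i ∉ F, s i ≤ τ) :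
    ∑ i ∈ T, s i ≤ ∑ i ∈ F, s i := by
  have key : ∑ i ∈ T, (s i - τ) ≤ ∑ i ∈ F, (s i - τ) := by
    rw [← Finset.sum_inter_add_sum_sdiff T F]
    have h1 : ∑ i ∈ T \ F, (s i - τ) ≤ 0 := Finset.sum_nonpos fun i hi => by
      have := hF' i (Finset.mem_sdiff.1 hi).2
      linarith
    have h2 : ∑ i ∈ T ∩ F, (s i - τ) ≤ ∑ i ∈ F, (s i - τ) :=
      Finset.sum_le_sum_of_subset_of_nonneg Finset.inter_subset_right fun i hi _ => by
        have := hF i hi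
        linarith
    linarith
  simp only [Finset.sum_sub_distrib, Finset.sum_const, nsmul_eq_mul] at key
  have : (T.card : ℝ) * τ ≤ F.card * τ := by gcongr
  linarith

lemma sum_le_headSum {a : α → ℝ} (ha : ∀ i, 0 ≤ a i) (T : Finset α) {K : ℝ}
    (hT : (T.card : ℝ) ≤ K) : ∑ i ∈ T, a i ≤ headSum a K := by
  classical
  have hT' : ∑ i ∈ T, a i = ∑ i ∈ T.map (descEquiv a).symm.toEmbedding, descSorted a i := by
    simp [descSorted_apply]
  have hK : 0 ≤ K := le_trans (Nat.cast_nonneg _) hT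
  rw [hT', headSum]
  by_cases hN : ⌊K⌋₊ < Fintype.card α
  · refine sum_le_sum_of_threshold (descSorted_nonneg ha ⟨⌊K⌋₊, hN⟩) ?_ ?_ ?_
    · rw [Finset.card_map]
      exact le_card_filter_succ (Finset.card_le_univ T) hT
    · intro i hi
      refine descSorted_antitone a ?_
      have : ((i : ℕ) + 1 : ℝ) ≤ K := by simpa using hi
      have := Nat.le_floor (n := (i : ℕ) + 1) (by exact_mod_cast this)
      exact Fin.mk_le_mk.2 (by omega)
    · intro i hi
      refine descSorted_antitone a ?_
      have : K < ((i : ℕ) + 1 : ℝ) := by simpa using hi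
      have := (Nat.floor_lt hK).2 (by exact_mod_cast this : K < (((i : ℕ) + 1 : ℕ) : ℝ))
      exact Fin.mk_le_mk.2 (by omega)
  · refine Finset.sum_le_sum_of_subset_of_nonneg (fun i _ => ?_)
      fun i _ _ => descSorted_nonneg ha i
    simp only [Finset.mem_filter, Finset.mem_univ, true_and]
    refine le_trans ?_ (Nat.floor_le hK)
    have := i.2
    exact_mod_cast (by omega : (i : ℕ) + 1 ≤ ⌊K⌋₊)

lemma headSum_le_sum_filter_add {a : α → ℝ} (ha : ∀ i, 0 ≤ a i) {K θ : ℝ} (hK : 0 ≤ K)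
    (hθ : 0 ≤ θ) : headSum a K ≤ ∑ i ∈ Finset.univ.filter (fun i => θ < a i), a i + K * θ := by
  have h1 : headSum a K ≤
      ∑ i ∈ Finset.univ.filter (fun i : Fin (Fintype.card α) => ((i : ℕ) + 1 : ℝ) ≤ K),
        ((if θ < descSorted a i then descSorted a i else 0) + θ) := by
    refine Finset.sum_le_sum fun i _ => ?_
    split_ifs with h
    · linarith
    · linarith
  refine h1.trans ?_
  rw [Finset.sum_add_distrib, Finset.sum_const, nsmul_eq_mul]
  refine add_le_add ?_ (mul_le_mul_of_nonneg_right (card_filter_succ_le _ hK) hθ)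
  rw [Finset.sum_filter (fun i => θ < a i),
    ← Equiv.sum_comp (descEquiv a) (fun i => if θ < a i then a i else 0)]
  refine Finset.sum_le_sum_of_subset_of_nonneg (Finset.subset_univ _) fun i _ _ => ?_
  have := descSorted_nonneg ha i
  split_ifs <;> first | exact this | exact le_rfl

lemma cutAndPile_nonneg {a : α → ℝ} (ha : ∀ i, 0 ≤ a i) (K : ℝ) (i : Fin (Fintype.card α)) :
    0 ≤ cutAndPile a K i := by
  have h1 := descSorted_nonneg ha i
  have h2 : 0 ≤ tailSum a K := Finset.sum_nonneg fun i _ => descSorted_nonneg ha i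
  unfold cutAndPile
  split_ifs <;> linarith

/-- Criterion for the cut-and-pile vector to majorise `b`. -/
lemma cutAndPile_maj {β : Type*} [Fintype β] [Nonempty α] {a : α → ℝ} {b : β → ℝ}
    (ha : IsProbDist a) (hb : IsProbDist b) {K : ℝ}
    (h : ∀ j : ℕ, 1 ≤ j → (j : ℝ) < K → headSum b j ≤ headSum a j + (1 - headSum a K)) :
    Maj (cutAndPile a K) b := by
  intro j
  rcases Nat.eq_zero_or_pos j with rfl | hj
  · have : headSum b ((0 : ℕ) : ℝ) = 0 := by
      refine Finset.sum_eq_zero fun i hi => ?_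
      have : ((i : ℕ) + 1 : ℝ) ≤ 0 := by simpa using hi
      have := (Nat.cast_nonneg (α := ℝ) (i : ℕ))
      linarith
    rw [this]
    exact headSum_nonneg (fun i => cutAndPile_nonneg ha.1 K i) _
  set F := Finset.univ.filter fun i : Fin (Fintype.card α) => ((i : ℕ) + 1 : ℝ) ≤ (j : ℝ) with hF
  have hsum : ∑ i ∈ F, cutAndPile a K i ≤ headSum (cutAndPile a K) j :=
    sum_le_headSum (fun i => cutAndPile_nonneg ha.1 K i) F
      (card_filter_succ_le _ (Nat.cast_nonneg j))
  refine le_trans ?_ hsum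
  let i₀ : Fin (Fintype.card α) := ⟨0, Fintype.card_pos⟩
  have hi₀ : i₀ ∈ F := by
    simp only [hF, Finset.mem_filter, Finset.mem_univ, true_and, i₀]
    exact_mod_cast (by omega : 0 + 1 ≤ j)
  have hge : tailSum a K + ∑ i ∈ F, (if ((i : ℕ) + 1 : ℝ) < K then descSorted a i else 0) ≤
      ∑ i ∈ F, cutAndPile a K i := by
    have h0 := descSorted_nonneg ha.1 i₀
    rw [← Finset.add_sum_erase F _ hi₀, ← Finset.add_sum_erase F _ hi₀, ← add_assoc]
    refine add_le_add ?_ (Finset.sum_le_sum fun i hi => ?_)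
    · simp only [cutAndPile, i₀, if_true]
      split_ifs <;> linarith
    · have hi' : (i : ℕ) ≠ 0 := fun h0 => (Finset.mem_erase.1 hi).1 (Fin.ext h0)
      simp [cutAndPile, hi']
  refine le_trans ?_ hge
  have htail := one_le_headSum_add_tailSum ha K
  rcases lt_or_ge (j : ℝ) K with hjK | hjK
  · have : ∑ i ∈ F, (if ((i : ℕ) + 1 : ℝ) < K then descSorted a i else 0) = headSum a j := by
      refine Finset.sum_congr rfl fun i hi => if_pos ?_
      have : ((i : ℕ) + 1 : ℝ) ≤ j := by simpa [hF] using hi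
      linarith
    rw [this]
    linarith [h j hj hjK]
  · have hone : 1 = ∑ i, descSorted a i := by rw [sum_descSorted, ha.2]
    refine ((headSum_le_one hb _).trans_eq hone).trans ?_
    rw [tailSum, Finset.sum_filter, hF, Finset.sum_filter, ← Finset.sum_add_distrib]
    refine Finset.sum_le_sum fun i _ => ?_
    have h0 := descSorted_nonneg ha.1 i
    rcases lt_or_ge ((i : ℕ) + 1 : ℝ) K with h1 | h1
    · rw [if_pos (h1.le.trans hjK), if_pos h1]
      split_ifs <;> linarith
    · rw [if_pos h1]
      split_ifs <;> linarith

end Sorting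

section EntropyGeneratingFunction

variable {α β : Type*} [Fintype α] [Fintype β]

/-- The moment generating function of the surprisal `-ln a`, centred at `h`. -/
def surprisalMgf (a : α → ℝ) (h l : ℝ) : ℝ := ∑ i, a i * Real.exp (l * (-Real.log (a i) - h))

lemma mul_exp_surprisal (x y h h' l : ℝ) :
    x * y * Real.exp (l * (-Real.log (x * y) - (h + h'))) =
      x * Real.exp (l * (-Real.log x - h)) * (y * Real.exp (l * (-Real.log y - h'))) := by
  rcases eq_or_ne x 0 with rfl | hx
  · simp
  rcases eq_or_ne y 0 with rfl | hy
  · simp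
  rw [Real.log_mul hx hy, mul_mul_mul_comm, ← Real.exp_add]
  congr 2
  ring

lemma prod_mul_exp_surprisal {ι : Type*} (s : Finset ι) (x : ι → ℝ) (h l : ℝ) :
    (∏ j ∈ s, x j) * Real.exp (l * (-Real.log (∏ j ∈ s, x j) - s.card * h)) =
      ∏ j ∈ s, (x j * Real.exp (l * (-Real.log (x j) - h))) := by
  classical
  induction s using Finset.induction_on with
  | empty => simp
  | insert j s hj ih =>
    rw [Finset.prod_insert hj, Finset.prod_insert hj, ← ih, ← mul_exp_surprisal,
      Finset.card_insert_of_notMem hj]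
    push_cast
    rw [add_mul, one_mul, add_comm h]

lemma surprisalMgf_tensor (a : α → ℝ) (b : β → ℝ) (h h' l : ℝ) :
    surprisalMgf (tensor a b) (h + h') l = surprisalMgf a h l * surprisalMgf b h' l := by
  simp_rw [surprisalMgf, tensor, mul_exp_surprisal, Fintype.sum_prod_type, Finset.sum_mul_sum]

lemma surprisalMgf_tpow (a : α → ℝ) (n : ℕ) (h l : ℝ) :
    surprisalMgf (tpow a n) (n * h) l = surprisalMgf a h l ^ n := by
  classical
  have := fun f : Fin n → α => prod_mul_exp_surprisal Finset.univ (fun j => a (f j)) h l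
  simp only [Finset.card_univ, Fintype.card_fin] at this
  simp_rw [surprisalMgf, tpow, this, Fintype.sum_pow]

lemma surprisalMgf_unif {d : ℕ} (hd : d ≠ 0) (l : ℝ) :
    surprisalMgf (unif d) (Real.log d) l = 1 := by
  have : (d : ℝ) ≠ 0 := by exact_mod_cast hd
  simp [surprisalMgf, unif, this]

lemma IsProbDist.tensor {a : α → ℝ} {b : β → ℝ} (ha : IsProbDist a) (hb : IsProbDist b) :
    IsProbDist (tensor a b) := by
  refine ⟨fun i => mul_nonneg (ha.1 _) (hb.1 _), ?_⟩
  simp_rw [_root_.tensor, Fintype.sum_prod_type, ← Finset.mul_sum, hb.2, mul_one, ha.2]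

lemma IsProbDist.tpow {a : α → ℝ} (ha : IsProbDist a) (n : ℕ) : IsProbDist (tpow a n) := by
  classical
  refine ⟨fun i => Finset.prod_nonneg fun _ _ => ha.1 _, ?_⟩
  simp_rw [_root_.tpow, ← Fintype.sum_pow, ha.2, one_pow]

lemma isProbDist_unif {d : ℕ} (hd : d ≠ 0) : IsProbDist (unif d) := by
  have : (d : ℝ) ≠ 0 := by exact_mod_cast hd
  exact ⟨fun i => by simp only [unif]; positivity, by simp [unif, this]⟩

lemma shannonH_eq_sum_negMulLog (a : α → ℝ) : shannonH a = ∑ i, Real.negMulLog (a i) := by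
  simp [shannonH, Real.negMulLog]

lemma shannonH_tensor {a : α → ℝ} {b : β → ℝ} (ha : IsProbDist a) (hb : IsProbDist b) :
    shannonH (tensor a b) = shannonH a + shannonH b := by
  simp_rw [shannonH_eq_sum_negMulLog, tensor, Fintype.sum_prod_type, Real.negMulLog_mul,
    Finset.sum_add_distrib, ← Finset.mul_sum, ← Finset.sum_mul, hb.2, one_mul, ha.2, one_mul]

lemma shannonH_tpow {a : α → ℝ} (ha : IsProbDist a) (n : ℕ) :
    shannonH (tpow a n) = n * shannonH a := by
  induction n with
  | zero => simp [shannonH, tpow]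
  | succ n ih =>
    have : shannonH (tpow a (n + 1)) = shannonH (tensor a (tpow a n)) := by
      rw [shannonH_eq_sum_negMulLog, shannonH_eq_sum_negMulLog,
        ← Equiv.sum_comp (Fin.consEquiv fun _ : Fin (n + 1) => α)]
      refine Finset.sum_congr rfl fun x _ => ?_
      simp [tpow, tensor, Fin.consEquiv, Fin.prod_univ_succ]
    rw [this, shannonH_tensor ha (ha.tpow n), ih]
    push_cast
    ring

lemma shannonH_unif {d : ℕ} (hd : d ≠ 0) : shannonH (unif d) = Real.log d := by
  have : (d : ℝ) ≠ 0 := by exact_mod_cast hd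
  simp [shannonH, unif, this]

lemma relD_unif {d : ℕ} {p : Fin d → ℝ} (hp : IsProbDist p) :
    relD p (unif d) = Real.log d - shannonH p := by
  have : ∀ i, p i * Real.log (p i / unif d i) = p i * Real.log d + p i * Real.log (p i) := by
    intro i
    rcases eq_or_ne (p i) 0 with h | h
    · simp [h]
    have hd : (d : ℝ) ≠ 0 := by
      have := i.pos
      exact_mod_cast this.ne'
    rw [unif, div_div_eq_mul_div, div_one, Real.log_mul h hd]
    ring
  simp_rw [relD, this, Finset.sum_add_distrib, ← Finset.sum_mul, hp.2, shannonH]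
  ring

lemma relV_unif {d : ℕ} {p : Fin d → ℝ} (hp : IsProbDist p) :
    relV p (unif d) = ∑ i, p i * (-Real.log (p i) - shannonH p) ^ 2 := by
  refine Finset.sum_congr rfl fun i _ => ?_
  rcases eq_or_ne (p i) 0 with h | h
  · simp [h]
  have hd : (d : ℝ) ≠ 0 := by
    have := i.pos
    exact_mod_cast this.ne'
  rw [relD_unif hp, unif, div_div_eq_mul_div, div_one, Real.log_mul h hd]
  ring

lemma sum_mul_surprisal {a : α → ℝ} (ha : IsProbDist a) :
    ∑ i, a i * (-Real.log (a i) - shannonH a) = 0 := by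
  simp_rw [mul_sub, mul_neg, Finset.sum_sub_distrib, ← Finset.sum_mul, ha.2, shannonH,
    Finset.sum_neg_distrib]
  ring

/-- A finite centred random variable has a nearly Gaussian moment generating function near `0`. -/
lemma exists_mgf_near_gaussian {a x : α → ℝ} (ha : IsProbDist a) {V : ℝ}
    (hmean : ∑ i, a i * x i = 0) (hvar : ∑ i, a i * x i ^ 2 = V) {δ : ℝ} (hδ : 0 < δ) :
    ∃ l₀ > (0 : ℝ), ∀ l : ℝ, |l| ≤ l₀ →
      Real.exp ((V - δ) * l ^ 2 / 2) ≤ ∑ i, a i * Real.exp (l * x i) ∧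
      ∑ i, a i * Real.exp (l * x i) ≤ Real.exp ((V + δ) * l ^ 2 / 2) := by
  obtain ⟨B, hB⟩ : ∃ B : ℝ, ∀ i, |x i| ≤ B := by
    obtain ⟨B, hB⟩ := (Set.finite_range fun i => |x i|).bddAbove
    exact ⟨B, fun i => hB ⟨i, rfl⟩⟩
  have hB1 : ∀ i, |x i| ≤ max B 1 := fun i => (hB i).trans (le_max_left _ _)
  set C := max B 1
  have hC1 : 1 ≤ C := le_max_right _ _
  have hC0 : 0 < C := by linarith
  have hV : 0 ≤ V := hvar ▸ Finset.sum_nonneg fun i _ => mul_nonneg (ha.1 i) (sq_nonneg _)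
  have key : ∀ l : ℝ, |l| * C ≤ 1 →
      |∑ i, a i * Real.exp (l * x i) - (1 + V * l ^ 2 / 2)| ≤ C ^ 3 * |l| ^ 3 := by
    intro l hl
    have hexp : ∀ i, |Real.exp (l * x i) - (1 + l * x i + (l * x i) ^ 2 / 2)| ≤
        C ^ 3 * |l| ^ 3 := by
      intro i
      have h1 : |l * x i| ≤ |l| * C := by
        rw [abs_mul]
        exact mul_le_mul_of_nonneg_left (hB1 i) (abs_nonneg l)
      have h2 := Real.exp_bound (h1.trans hl) (n := 3) (by norm_num)
      have h3 : |l * x i| ^ 3 ≤ (|l| * C) ^ 3 := pow_le_pow_left₀ (abs_nonneg _) h1 3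
      have h4 : ∑ k ∈ Finset.range 3, (l * x i) ^ k / (k.factorial : ℝ) =
          1 + l * x i + (l * x i) ^ 2 / 2 := by
        simp [Finset.sum_range_succ]
      rw [h4] at h2
      norm_num [Nat.factorial] at h2
      rw [mul_pow] at h3
      have h5 : 0 ≤ |l * x i| ^ 3 := by positivity
      rw [abs_mul] at h3 h5
      nlinarith
    have hsum : ∑ i, a i * Real.exp (l * x i) - (1 + V * l ^ 2 / 2) =
        ∑ i, a i * (Real.exp (l * x i) - (1 + l * x i + (l * x i) ^ 2 / 2)) := by
      have h1 : ∀ i, a i * (Real.exp (l * x i) - (1 + l * x i + (l * x i) ^ 2 / 2)) =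
          a i * Real.exp (l * x i) - (a i + l * (a i * x i) + l ^ 2 / 2 * (a i * x i ^ 2)) :=
        fun i => by ring
      simp_rw [h1, Finset.sum_sub_distrib, Finset.sum_add_distrib, ← Finset.mul_sum, hmean, hvar,
        ha.2]
      ring
    rw [hsum]
    refine (Finset.abs_sum_le_sum_abs _ _).trans ?_
    calc ∑ i, |a i * (Real.exp (l * x i) - (1 + l * x i + (l * x i) ^ 2 / 2))|
        ≤ ∑ i, a i * (C ^ 3 * |l| ^ 3) := Finset.sum_le_sum fun i _ => by
          rw [abs_mul, abs_of_nonneg (ha.1 i)]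
          exact mul_le_mul_of_nonneg_left (hexp i) (ha.1 i)
      _ = C ^ 3 * |l| ^ 3 := by rw [← Finset.sum_mul, ha.2, one_mul]
  have hpos : 0 < (1 + V + δ) ^ 2 := by positivity
  refine ⟨min (1 / C) (min (δ / (4 * C ^ 3)) (min 1 (δ / (1 + V + δ) ^ 2))), by positivity,
    fun l hl => ?_⟩
  simp only [le_min_iff] at hl
  obtain ⟨hl1, hl2, hl3, hl4⟩ := hl
  rw [le_div_iff₀ hC0] at hl1
  rw [le_div_iff₀ (by positivity)] at hl2 hl4
  have hk := abs_le.1 (key l hl1)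
  have hl0 : 0 ≤ |l| := abs_nonneg l
  have hsq : |l| ^ 2 = l ^ 2 := sq_abs l
  have hrem : C ^ 3 * |l| ^ 3 ≤ δ / 4 * l ^ 2 := by
    rw [← hsq]
    nlinarith [sq_nonneg |l|]
  have hl2n : 0 ≤ l ^ 2 := sq_nonneg l
  constructor
  · rcases le_total (V - δ) 0 with hn | hn
    · have h1 : Real.exp ((V - δ) * l ^ 2 / 2) ≤ 1 := by
        rw [Real.exp_le_one_iff]
        nlinarith
      have h2 : (1 : ℝ) ≤ ∑ i, a i * Real.exp (l * x i) := by
        calc (1 : ℝ) = ∑ i, a i * (l * x i + 1) := by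
              have : ∀ i, a i * (l * x i + 1) = l * (a i * x i) + a i := fun i => by ring
              simp_rw [this, Finset.sum_add_distrib, ← Finset.mul_sum, hmean, ha.2]
              ring
          _ ≤ _ := Finset.sum_le_sum fun i _ =>
              mul_le_mul_of_nonneg_left (Real.add_one_le_exp _) (ha.1 i)
      exact h1.trans h2
    · set u := (V - δ) * l ^ 2 / 2 with hu
      have hl2le : l ^ 2 * (1 + V + δ) ^ 2 ≤ δ := by
        rw [← hsq]
        nlinarith
      have hu0 : 0 ≤ u := by positivity
      have hVδ : (V - δ) ^ 2 ≤ (1 + V + δ) ^ 2 := by nlinarith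
      have hu2 : u ^ 2 ≤ δ / 4 * l ^ 2 := by
        have : u ^ 2 = (V - δ) ^ 2 * l ^ 2 * l ^ 2 / 4 := by rw [hu]; ring
        rw [this]
        nlinarith [mul_le_mul_of_nonneg_right hVδ hl2n]
      have hu1 : u ≤ 1 := by
        have h1 : l ^ 2 ≤ 1 := by nlinarith
        by_contra! hcon
        have h2 := mul_le_mul_of_nonneg_left h1 hn
        have h3 : 2 ≤ V - δ := by linarith
        nlinarith
      have hexp : Real.exp u ≤ 1 + u + u ^ 2 := by
        have := Real.abs_exp_sub_one_sub_id_le (x := u) (by rw [abs_of_nonneg hu0]; exact hu1)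
        have := (abs_le.1 this).2
        linarith
      nlinarith
  · refine le_trans ?_ (Real.add_one_le_exp _)
    nlinarith

/-- Near-Gaussian bounds on the surprisal generating function of a single distribution. -/
lemma exists_surprisalMgf_near_gaussian {d : ℕ} {p : Fin d → ℝ} (hp : IsProbDist p) {δ : ℝ}
    (hδ : 0 < δ) : ∃ l₀ > (0 : ℝ), ∀ l : ℝ, |l| ≤ l₀ →
      Real.exp ((relV p (unif d) - δ) * l ^ 2 / 2) ≤ surprisalMgf p (shannonH p) l ∧
      surprisalMgf p (shannonH p) l ≤ Real.exp ((relV p (unif d) + δ) * l ^ 2 / 2) :=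
  exists_mgf_near_gaussian hp (sum_mul_surprisal hp) (relV_unif hp).symm hδ

end EntropyGeneratingFunction

section ModerateDeviations

lemma sum_filter_le_exp_mul_mgf {α : Type*} [Fintype α] {w : α → ℝ} (hw : ∀ i, 0 ≤ w i)
    (S : α → ℝ) {l a : ℝ} (hl : 0 ≤ l) :
    ∑ i ∈ Finset.univ.filter (fun i => a ≤ S i), w i ≤
      Real.exp (-(l * a)) * ∑ i, w i * Real.exp (l * S i) := by
  rw [Finset.sum_filter, Finset.mul_sum]
  refine Finset.sum_le_sum fun i _ => ?_
  rw [mul_left_comm, ← Real.exp_add]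
  split_ifs with h
  · refine le_mul_of_one_le_right (hw i) (Real.one_le_exp ?_)
    nlinarith
  · exact mul_nonneg (hw i) (Real.exp_pos _).le

/-- A lower bound on an upper tail in terms of three values of the moment generating function. -/
lemma mgf_sub_le_sum_filter {α : Type*} [Fintype α] {w : α → ℝ} (hw : ∀ i, 0 ≤ w i)
    (S : α → ℝ) {l e a b : ℝ} (hl : 0 ≤ l) (he : 0 ≤ e) :
    ∑ i, w i * Real.exp (l * S i) ≤
      Real.exp (l * b) * ∑ i ∈ Finset.univ.filter (fun i => a ≤ S i), w i +
      Real.exp (e * a) * ∑ i, w i * Real.exp ((l - e) * S i) +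
      Real.exp (-(e * b)) * ∑ i, w i * Real.exp ((l + e) * S i) := by
  rw [Finset.sum_filter, Finset.mul_sum, Finset.mul_sum, Finset.mul_sum,
    ← Finset.sum_add_distrib, ← Finset.sum_add_distrib]
  refine Finset.sum_le_sum fun i _ => ?_
  have h1 : 0 ≤ Real.exp (l * b) * (if a ≤ S i then w i else 0) := by
    have := hw i
    split_ifs <;> positivity
  have h2 : Real.exp (e * a) * (w i * Real.exp ((l - e) * S i)) =
      w i * Real.exp (e * a + (l - e) * S i) := by rw [mul_left_comm, ← Real.exp_add]
  have h3 : Real.exp (-(e * b)) * (w i * Real.exp ((l + e) * S i)) =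
      w i * Real.exp (-(e * b) + (l + e) * S i) := by rw [mul_left_comm, ← Real.exp_add]
  rw [h2, h3]
  have h2' : 0 ≤ w i * Real.exp (e * a + (l - e) * S i) :=
    mul_nonneg (hw i) (Real.exp_pos _).le
  have h3' : 0 ≤ w i * Real.exp (-(e * b) + (l + e) * S i) :=
    mul_nonneg (hw i) (Real.exp_pos _).le
  rcases lt_or_ge (S i) a with ha | ha
  · have : w i * Real.exp (l * S i) ≤ w i * Real.exp (e * a + (l - e) * S i) := by
      refine mul_le_mul_of_nonneg_left (Real.exp_le_exp.2 ?_) (hw i)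
      nlinarith
    linarith
  rcases lt_or_ge b (S i) with hb | hb
  · have : w i * Real.exp (l * S i) ≤ w i * Real.exp (-(e * b) + (l + e) * S i) := by
      refine mul_le_mul_of_nonneg_left (Real.exp_le_exp.2 ?_) (hw i)
      nlinarith
    linarith
  · rw [if_pos ha]
    have : w i * Real.exp (l * S i) ≤ Real.exp (l * b) * w i := by
      rw [mul_comm]
      exact mul_le_mul_of_nonneg_right (Real.exp_le_exp.2 (mul_le_mul_of_nonneg_left hb hl)) (hw i)
    linarith

variable {Ω : ℕ → Type} [∀ n, Fintype (Ω n)]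

/-- The random variables `S n` under the weights `w n` have, near the origin, the moment generating
function of a centred Gaussian of variance about `v * n`. -/
def NearGaussianMgf (w S : ∀ n, Ω n → ℝ) (v : ℝ) : Prop :=
  ∀ δ > (0 : ℝ), ∃ l₀ > (0 : ℝ), ∀ᶠ n : ℕ in atTop, ∀ l : ℝ, |l| ≤ l₀ →
    Real.exp ((v - δ) * n * l ^ 2 / 2) ≤ ∑ i, w n i * Real.exp (l * S n i) ∧
    ∑ i, w n i * Real.exp (l * S n i) ≤ Real.exp ((v + δ) * n * l ^ 2 / 2)

lemma NearGaussianMgf.neg {w S : ∀ n, Ω n → ℝ} {v : ℝ} (h : NearGaussianMgf w S v) :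
    NearGaussianMgf w (fun n i => -S n i) v := by
  intro δ hδ
  obtain ⟨l₀, hl₀, h⟩ := h δ hδ
  refine ⟨l₀, hl₀, h.mono fun n hn l hl => ?_⟩
  have := hn (-l) (by rwa [abs_neg])
  simpa only [neg_mul_comm, neg_sq, mul_neg] using this

lemma ModerateSeq.eventually_pos {t : ℕ → ℝ} (ht : ModerateSeq t) :
    ∀ᶠ n : ℕ in atTop, 0 < t n ∧ 0 < (n : ℝ) := by
  filter_upwards [ht.2.eventually_gt_atTop 0, eventually_gt_atTop 0] with n hn hn'
  have h : 0 < (n : ℝ) := by exact_mod_cast hn'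
  exact ⟨pos_of_mul_pos_right hn (Real.sqrt_nonneg _), h⟩

lemma ModerateSeq.tendsto_mul_sq {t : ℕ → ℝ} (ht : ModerateSeq t) :
    Tendsto (fun n : ℕ => (n : ℝ) * t n ^ 2) atTop atTop := by
  refine (ht.2.atTop_mul_atTop₀ ht.2).congr fun n => ?_
  rw [mul_mul_mul_comm, Real.mul_self_sqrt (Nat.cast_nonneg n), sq]

lemma ModerateSeq.tendsto_mul {t : ℕ → ℝ} (ht : ModerateSeq t) :
    Tendsto (fun n : ℕ => (n : ℝ) * t n) atTop atTop := by
  refine tendsto_atTop_mono' _ ?_ ht.tendsto_mul_sq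
  filter_upwards [ht.eventually_pos, ht.1.eventually_lt_const one_pos] with n hn hn'
  have : t n ^ 2 ≤ t n := by nlinarith [hn.1]
  exact mul_le_mul_of_nonneg_left this hn.2.le

lemma ModerateSeq.eventually_mul_le {t : ℕ → ℝ} (ht : ModerateSeq t) (c : ℝ) {l₀ : ℝ}
    (hl₀ : 0 < l₀) : ∀ᶠ n : ℕ in atTop, |c * t n| ≤ l₀ := by
  have : Tendsto (fun n => |c * t n|) atTop (𝓝 0) := by simpa using (ht.1.const_mul c).abs
  filter_upwards [this.eventually_lt_const hl₀] with n hn using hn.le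

variable {w S : ∀ n, Ω n → ℝ} {v : ℝ} {t : ℕ → ℝ}

/-- Moderate deviation upper bound. -/
lemma NearGaussianMgf.eventually_tail_le (h : NearGaussianMgf w S v) (hw : ∀ n i, 0 ≤ w n i)
    (hv : 0 < v) (ht : ModerateSeq t) {c r : ℝ} (hc : 0 < c) (hr : r < c ^ 2 / (2 * v)) :
    ∀ᶠ n : ℕ in atTop, ∑ i ∈ Finset.univ.filter (fun i => c * (n * t n) ≤ S n i), w n i ≤
      Real.exp (-r * (n * t n ^ 2)) := by
  obtain ⟨δ, hδ, hrδ⟩ : ∃ δ > 0, r < c ^ 2 / (2 * (v + δ)) := by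
    have hcont : ContinuousAt (fun δ : ℝ => c ^ 2 / (2 * (v + δ))) 0 := by
      refine ContinuousAt.div continuousAt_const (by fun_prop) ?_
      simpa using hv.ne'
    have := (hcont.eventually_const_lt (by simpa using hr)).filter_mono
      (nhdsWithin_le_nhds (s := Set.Ioi 0))
    obtain ⟨δ, h1, h2⟩ := (this.and self_mem_nhdsWithin).exists
    exact ⟨δ, h2, h1⟩
  obtain ⟨l₀, hl₀, h⟩ := h δ hδ
  filter_upwards [h, ht.eventually_pos, ht.eventually_mul_le (c / (v + δ)) hl₀]
    with n hn ⟨htn, hn0⟩ hl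
  have hvδ : 0 < v + δ := by positivity
  refine (sum_filter_le_exp_mul_mgf (hw n) (S n) (l := c / (v + δ) * t n)
    (by positivity)).trans ?_
  refine (mul_le_mul_of_nonneg_left (hn _ hl).2 (Real.exp_pos _).le).trans ?_
  rw [← Real.exp_add, Real.exp_le_exp]
  have : -(c / (v + δ) * t n * (c * (n * t n))) + (v + δ) * n * (c / (v + δ) * t n) ^ 2 / 2 =
      -(c ^ 2 / (2 * (v + δ))) * (n * t n ^ 2) := by
    field_simp
    ring
  rw [this]
  have : 0 ≤ (n : ℝ) * t n ^ 2 := by positivity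
  nlinarith

lemma tilt_exponent_bounds {η κ : ℝ} (hη : 0 < η) (hη1 : η ≤ 1) (hκ : κ = η ^ 2 / 26) :
    η + (1 + κ) / 2 ≤ (1 - κ) * (1 + η) ^ 2 / 2 - η ^ 2 / 4 ∧
    -(η * (1 + 2 * η)) + (1 + κ) * (1 + 2 * η) ^ 2 / 2 ≤
      (1 - κ) * (1 + η) ^ 2 / 2 - η ^ 2 / 4 ∧
    (1 + η) * (1 + 2 * η) - (1 / 2 + 8 * η) + η ≤ (1 - κ) * (1 + η) ^ 2 / 2 := by
  have hκ0 : 0 ≤ κ := by rw [hκ]; positivity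
  have hsq : η ^ 2 ≤ η := by nlinarith
  have h1 : κ * (1 + η) ^ 2 ≤ κ * 4 := mul_le_mul_of_nonneg_left (by linarith) hκ0
  have h2 : κ * (1 + 2 * η) ^ 2 ≤ κ * 9 := mul_le_mul_of_nonneg_left (by linarith) hκ0
  refine ⟨?_, ?_, ?_⟩ <;> linarith

/-- Moderate deviation lower bound. -/
lemma NearGaussianMgf.eventually_le_tail (h : NearGaussianMgf w S v) (hw : ∀ n i, 0 ≤ w n i)
    (hv : 0 < v) (ht : ModerateSeq t) {c r : ℝ} (hc : 0 < c) (hr : c ^ 2 / (2 * v) < r) :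
    ∀ᶠ n : ℕ in atTop, Real.exp (-r * (n * t n ^ 2)) ≤
      ∑ i ∈ Finset.univ.filter (fun i => c * (n * t n) ≤ S n i), w n i := by
  -- in units of `c² / v`, the rate `R` exceeds `1 / 2`
  set R := r * v / c ^ 2 with hR
  have hR2 : 1 / 2 < R := by
    rw [div_lt_iff₀ (by positivity)] at hr
    rw [hR, lt_div_iff₀ (by positivity)]
    linarith
  obtain ⟨η, hη, hη1, hηR⟩ : ∃ η > 0, η ≤ 1 ∧ 8 * η ≤ R - 1 / 2 :=
    ⟨min 1 ((R - 1 / 2) / 8), lt_min one_pos (by linarith), min_le_left _ _, by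
      have := min_le_right 1 ((R - 1 / 2) / 8)
      linarith⟩
  set κ := η ^ 2 / 26 with hκ
  have hκ0 : 0 < κ := by positivity
  obtain ⟨p1, p2, p3⟩ := tilt_exponent_bounds hη hη1 hκ
  obtain ⟨l₀, hl₀, h⟩ := h (κ * v) (by positivity)
  have hA : Tendsto (fun n : ℕ => c ^ 2 / v * ((n : ℝ) * t n ^ 2)) atTop atTop :=
    ht.tendsto_mul_sq.const_mul_atTop (by positivity)
  filter_upwards [h, ht.eventually_pos, ht.eventually_mul_le ((1 + η) * c / v) hl₀,
    ht.eventually_mul_le (c / v) hl₀, ht.eventually_mul_le ((1 + 2 * η) * c / v) hl₀,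
    hA.eventually_ge_atTop (Real.log 4 * (4 / η ^ 2)),
    hA.eventually_ge_atTop (Real.log 2 / η)] with n hn ⟨htn, hn0⟩ hl1 hl2 hl3 hA1 hA2
  set A := c ^ 2 / v * ((n : ℝ) * t n ^ 2) with hAdef
  have hA0 : 0 < A := by positivity
  have hη2 : Real.log 4 ≤ η ^ 2 / 4 * A := by
    rw [← mul_div_assoc, div_le_iff₀ (by positivity)] at hA1
    linarith
  have hη3 : Real.log 2 ≤ η * A := by
    rwa [div_le_iff₀ hη, mul_comm] at hA2
  have hbase := mgf_sub_le_sum_filter (hw n) (S n) (l := (1 + η) * c / v * t n)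
    (e := η * c / v * t n) (a := c * (n * t n)) (b := (1 + 2 * η) * (c * (n * t n)))
    (by positivity) (by positivity)
  have e1 : (1 + η) * c / v * t n - η * c / v * t n = c / v * t n := by ring
  have e2 : (1 + η) * c / v * t n + η * c / v * t n = (1 + 2 * η) * c / v * t n := by ring
  rw [e1, e2] at hbase
  have hM := (hn _ hl1).1
  have hM1 := (hn _ hl2).2
  have hM2 := (hn _ hl3).2
  have f0 : (v - κ * v) * n * ((1 + η) * c / v * t n) ^ 2 / 2 =
      (1 - κ) * (1 + η) ^ 2 / 2 * A := by rw [hAdef]; field_simp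
  have f1 : (v + κ * v) * n * (c / v * t n) ^ 2 / 2 = (1 + κ) / 2 * A := by
    rw [hAdef]; field_simp
  have f2 : (v + κ * v) * n * ((1 + 2 * η) * c / v * t n) ^ 2 / 2 =
      (1 + κ) * (1 + 2 * η) ^ 2 / 2 * A := by rw [hAdef]; field_simp
  have g0 : (1 + η) * c / v * t n * ((1 + 2 * η) * (c * (n * t n))) =
      (1 + η) * (1 + 2 * η) * A := by rw [hAdef]; field_simp
  have g1 : η * c / v * t n * (c * (n * t n)) = η * A := by rw [hAdef]; field_simp
  have g2 : η * c / v * t n * ((1 + 2 * η) * (c * (n * t n))) = η * (1 + 2 * η) * A := by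
    rw [hAdef]; field_simp
  have hrA : -r * (n * t n ^ 2) = -R * A := by rw [hAdef, hR]; field_simp
  rw [f0] at hM
  rw [f1] at hM1
  rw [f2] at hM2
  rw [g0, g1, g2] at hbase
  rw [hrA]
  set T := ∑ i ∈ Finset.univ.filter (fun i => c * (n * t n) ≤ S n i), w n i
  set E := (1 - κ) * (1 + η) ^ 2 / 2
  have hquarter : ∀ y ≤ (E - η ^ 2 / 4) * A, Real.exp y ≤ Real.exp (E * A) / 4 := by
    intro y hy
    have : Real.exp (E * A) / 4 = Real.exp (E * A - Real.log 4) := by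
      rw [Real.exp_sub, Real.exp_log (by norm_num)]
    rw [this, Real.exp_le_exp]
    linarith
  have k1 : Real.exp (η * A) * Real.exp ((1 + κ) / 2 * A) ≤ Real.exp (E * A) / 4 := by
    rw [← Real.exp_add, ← add_mul]
    refine hquarter _ (mul_le_mul_of_nonneg_right ?_ hA0.le)
    linarith
  have k2 : Real.exp (-(η * (1 + 2 * η) * A)) * Real.exp ((1 + κ) * (1 + 2 * η) ^ 2 / 2 * A) ≤
      Real.exp (E * A) / 4 := by
    rw [← Real.exp_add, ← neg_mul, ← add_mul]
    refine hquarter _ (mul_le_mul_of_nonneg_right ?_ hA0.le)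
    linarith
  have hT2 : Real.exp (E * A) / 2 ≤ Real.exp ((1 + η) * (1 + 2 * η) * A) * T := by
    have h1 := mul_le_mul_of_nonneg_left hM1 (Real.exp_pos (η * A)).le
    have h2 := mul_le_mul_of_nonneg_left hM2 (Real.exp_pos (-(η * (1 + 2 * η) * A))).le
    linarith
  have hfin : Real.exp ((1 + η) * (1 + 2 * η) * A) * Real.exp (-R * A) ≤
      Real.exp (E * A) / 2 := by
    have : Real.exp (E * A) / 2 = Real.exp (E * A - Real.log 2) := by
      rw [Real.exp_sub, Real.exp_log (by norm_num)]
    rw [this, ← Real.exp_add, Real.exp_le_exp]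
    have : ((1 + η) * (1 + 2 * η) - R + η) * A ≤ E * A := by
      refine mul_le_mul_of_nonneg_right ?_ hA0.le
      linarith
    linarith
  exact le_of_mul_le_mul_left (hfin.trans hT2) (Real.exp_pos _)

end ModerateDeviations

section HeadSums

lemma sum_filter_of_ne_zero {α : Type*} [Fintype α] (a : α → ℝ) (P : α → Prop)
    [DecidablePred P] [DecidablePred fun i => a i ≠ 0 ∧ P i] :
    ∑ i ∈ Finset.univ.filter (fun i => a i ≠ 0 ∧ P i), a i =
      ∑ i ∈ Finset.univ.filter P, a i := by
  rw [Finset.sum_filter, Finset.sum_filter]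
  refine Finset.sum_congr rfl fun i _ => ?_
  by_cases h : a i = 0
  · simp [h]
  · simp [h]

/-- The entries above the level `exp (-s)` number at most `exp s`. -/
lemma sum_filter_neg_log_le_headSum {α : Type*} [Fintype α] {a : α → ℝ} (ha : IsProbDist a)
    {s K : ℝ} (hK : Real.exp s ≤ K) :
    ∑ i ∈ Finset.univ.filter (fun i => -Real.log (a i) ≤ s), a i ≤ headSum a K := by
  classical
  rw [← sum_filter_of_ne_zero a (fun i => -Real.log (a i) ≤ s)]
  refine sum_le_headSum ha.1 _ (le_trans ?_ hK)
  set T := Finset.univ.filter fun i => a i ≠ 0 ∧ -Real.log (a i) ≤ s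
  have h1 : (T.card : ℝ) * Real.exp (-s) ≤ 1 := by
    rw [← ha.2, ← nsmul_eq_mul]
    refine (Finset.card_nsmul_le_sum T a _ fun i hi => ?_).trans
      (Finset.sum_le_sum_of_subset_of_nonneg (Finset.subset_univ _) fun i _ _ => ha.1 i)
    obtain ⟨h0, h1⟩ := (Finset.mem_filter.1 hi).2
    rw [← Real.le_log_iff_exp_le (lt_of_le_of_ne (ha.1 i) h0.symm)]
    linarith
  rwa [Real.exp_neg, ← div_eq_mul_inv, div_le_one (Real.exp_pos _)] at h1

lemma headSum_le_sum_filter_neg_log {α : Type*} [Fintype α] {a : α → ℝ} (ha : IsProbDist a)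
    (s k : ℝ) : headSum a (Real.exp k) ≤
      ∑ i ∈ Finset.univ.filter (fun i => -Real.log (a i) < s), a i + Real.exp (k - s) := by
  refine (headSum_le_sum_filter_add ha.1 (Real.exp_pos k).le (Real.exp_pos (-s)).le).trans ?_
  rw [← Real.exp_add, ← sub_eq_add_neg]
  refine add_le_add (Finset.sum_le_sum_of_subset_of_nonneg
    (Finset.monotone_filter_right _ fun i _ hi => ?_) fun i _ _ => ha.1 i) le_rfl
  have := (Real.lt_log_iff_exp_lt ((Real.exp_pos _).trans hi)).2 hi
  linarith

lemma sum_filter_add_sum_filter_eq_one {α : Type*} [Fintype α] {a : α → ℝ} (ha : IsProbDist a)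
    (x : α → ℝ) (s : ℝ) :
    ∑ i ∈ Finset.univ.filter (fun i => x i < s), a i +
      ∑ i ∈ Finset.univ.filter (fun i => s ≤ x i), a i = 1 := by
  rw [← ha.2, ← Finset.sum_filter_add_sum_filter_not Finset.univ (fun i => x i < s)]
  simp only [not_lt]

lemma ModerateSeq.eventually_exp_add_exp_le {t : ℕ → ℝ} (ht : ModerateSeq t) {r r' ε : ℝ}
    (hr : r < r') (hε : 0 < ε) : ∀ᶠ n : ℕ in atTop,
      Real.exp (-r' * (n * t n ^ 2)) + Real.exp (-ε * (n * t n)) ≤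
        Real.exp (-r * (n * t n ^ 2)) := by
  filter_upwards [(ht.tendsto_mul_sq.const_mul_atTop (sub_pos.2 hr)).eventually_ge_atTop
    (Real.log 2), (ht.tendsto_mul.const_mul_atTop (half_pos hε)).eventually_ge_atTop
    (Real.log 2), ht.eventually_pos, ht.eventually_mul_le r (half_pos hε)]
    with n h1 h2 ⟨htn, hn⟩ h3
  have hhalf : ∀ y ≤ -r * (n * t n ^ 2) - Real.log 2,
      Real.exp y ≤ Real.exp (-r * (n * t n ^ 2)) / 2 := by
    intro y hy
    have : Real.exp (-r * (n * t n ^ 2)) / 2 =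
        Real.exp (-r * (n * t n ^ 2) - Real.log 2) := by
      rw [Real.exp_sub, Real.exp_log (by norm_num)]
    rwa [this, Real.exp_le_exp]
  have k1 := hhalf (-r' * (n * t n ^ 2)) (by linarith)
  have k2 := hhalf (-ε * (n * t n)) (by
    have : r * t n * (n * t n) ≤ ε / 2 * (n * t n) :=
      mul_le_mul_of_nonneg_right ((le_abs_self _).trans h3) (by positivity)
    linarith)
  linarith

lemma exists_gt_of_sq_max_div_lt {x v r : ℝ} (hr : max x 0 ^ 2 / (2 * v) < r) :
    ∃ c > 0, x < c ∧ c ^ 2 / (2 * v) < r := by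
  have hcont : ContinuousAt (fun c : ℝ => c ^ 2 / (2 * v)) (max x 0) := by fun_prop
  have := (hcont.eventually_lt_const hr).filter_mono (nhdsWithin_le_nhds (s := Set.Ioi (max x 0)))
  obtain ⟨c, h1, h2⟩ := (this.and self_mem_nhdsWithin).exists
  have h2 : max x 0 < c := h2
  exact ⟨c, (le_max_right _ _).trans_lt h2, (le_max_left _ _).trans_lt h2, h1⟩

lemma exists_lt_of_lt_sq_max_div {x v r : ℝ} (hx : 0 < x) (hr : r < max x 0 ^ 2 / (2 * v)) :
    ∃ c > 0, c < x ∧ r < c ^ 2 / (2 * v) := by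
  rw [max_eq_left hx.le] at hr
  have hcont : ContinuousAt (fun c : ℝ => c ^ 2 / (2 * v)) x := by fun_prop
  have h := (hcont.eventually_const_lt hr).filter_mono (nhdsWithin_le_nhds (s := Set.Iio x))
  have h' : ∀ᶠ c in 𝓝[<] x, 0 < c := (eventually_gt_nhds hx).filter_mono nhdsWithin_le_nhds
  obtain ⟨c, ⟨h1, h2⟩, h3⟩ := ((h.and h').and self_mem_nhdsWithin).exists
  exact ⟨c, h2, h3, h1⟩

/-- The moderate-deviation behaviour, at rate `1 / (2 * v)`, of the head and tail masses of a
sequence of distributions around the cut `exp (h n + μ * n * t n)`, with `h n` a reference entropy. -/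
structure HeadRates {Ω : ℕ → Type} [∀ n, Fintype (Ω n)] (A : ∀ n, Ω n → ℝ) (h t : ℕ → ℝ)
    (μ v : ℝ) : Prop where
  le_head : ∀ x r, max (μ - x) 0 ^ 2 / (2 * v) < r → ∀ᶠ n : ℕ in atTop,
    Real.exp (-r * (n * t n ^ 2)) ≤ headSum (A n) (Real.exp (h n + x * n * t n))
  head_le : ∀ x r, r < max (μ - x) 0 ^ 2 / (2 * v) → ∀ᶠ n : ℕ in atTop,
    headSum (A n) (Real.exp (h n + x * n * t n)) ≤ Real.exp (-r * (n * t n ^ 2))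
  le_tail : ∀ x r, max (x - μ) 0 ^ 2 / (2 * v) < r → ∀ᶠ n : ℕ in atTop,
    Real.exp (-r * (n * t n ^ 2)) ≤ 1 - headSum (A n) (Real.exp (h n + x * n * t n))
  tail_le : ∀ x r, r < max (x - μ) 0 ^ 2 / (2 * v) → ∀ᶠ n : ℕ in atTop,
    1 - headSum (A n) (Real.exp (h n + x * n * t n)) ≤ Real.exp (-r * (n * t n ^ 2))

lemma NearGaussianMgf.headRates {Ω : ℕ → Type} [∀ n, Fintype (Ω n)] {A : ∀ n, Ω n → ℝ}
    {h h' t : ℕ → ℝ} {μ v : ℝ} (hA : ∀ n, IsProbDist (A n)) (ht : ModerateSeq t) (hv : 0 < v)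
    (hG : NearGaussianMgf A (fun n i => -Real.log (A n i) - h n) v)
    (hh : ∀ ε > (0 : ℝ), ∀ᶠ n : ℕ in atTop, |h n - h' n - μ * n * t n| ≤ ε * (n * t n)) :
    HeadRates A h' t μ v := by
  have hA0 := fun n => (hA n).1
  have htriv : ∀ r ≤ 0, ∀ n : ℕ, 1 ≤ Real.exp (-r * (n * t n ^ 2)) := fun r hr n =>
    Real.one_le_exp (mul_nonneg (by linarith) (by positivity))
  refine ⟨fun x r hr => ?_, fun x r hr => ?_, fun x r hr => ?_, fun x r hr => ?_⟩
  · obtain ⟨c, hc, hcx, hcr⟩ := exists_gt_of_sq_max_div_lt hr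
    filter_upwards [hG.neg.eventually_le_tail hA0 hv ht hc hcr,
      hh (c - (μ - x)) (sub_pos.2 hcx)] with n h1 h2
    refine h1.trans (le_trans (le_of_eq ?_) (sum_filter_neg_log_le_headSum (hA n)
      (s := h n - c * (n * t n)) (Real.exp_le_exp.2 ?_)))
    · congr 1
      ext i
      simp only [Finset.mem_filter, Finset.mem_univ, true_and]
      constructor <;> intro hi <;> linarith
    · have := (abs_le.1 h2).2
      linarith
  · rcases le_or_gt (μ - x) 0 with hx | hx
    · have hr0 : r ≤ 0 := by simpa [max_eq_right hx] using hr.le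
      exact Eventually.of_forall fun n => (headSum_le_one (hA n) _).trans (htriv r hr0 n)
    obtain ⟨c, hc, hcx, hcr⟩ := exists_lt_of_lt_sq_max_div hx hr
    obtain ⟨r', hr', hr'c⟩ := exists_between hcr
    have hε : 0 < (μ - x - c) / 2 := by linarith
    filter_upwards [hG.neg.eventually_tail_le hA0 hv ht hc hr'c, hh _ hε,
      ht.eventually_exp_add_exp_le hr' hε] with n h1 h2 h3
    refine ((headSum_le_sum_filter_neg_log (hA n) (h n - c * (n * t n)) _).trans
      (add_le_add (le_trans ?_ h1) (Real.exp_le_exp.2 ?_))).trans h3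
    · refine Finset.sum_le_sum_of_subset_of_nonneg (Finset.monotone_filter_right _ fun i _ hi => ?_)
        fun i _ _ => hA0 n i
      linarith
    · have := (abs_le.1 h2).1
      linarith
  · obtain ⟨c, hc, hcx, hcr⟩ := exists_gt_of_sq_max_div_lt hr
    obtain ⟨r', hr', hr'c⟩ := exists_between hcr
    have hε : 0 < (c - (x - μ)) / 2 := by linarith
    filter_upwards [hG.eventually_le_tail hA0 hv ht hc hr', hh _ hε,
      ht.eventually_exp_add_exp_le hr'c hε] with n h1 h2 h3
    have h4 := headSum_le_sum_filter_neg_log (hA n) (h n + c * (n * t n)) (h' n + x * n * t n)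
    have h5 := sum_filter_add_sum_filter_eq_one (hA n) (fun i => -Real.log (A n i))
      (h n + c * (n * t n))
    have h6 : Real.exp (h' n + x * n * t n - (h n + c * (n * t n))) ≤
        Real.exp (-((c - (x - μ)) / 2) * (n * t n)) := by
      have := (abs_le.1 h2).1
      exact Real.exp_le_exp.2 (by linarith)
    simp only [le_sub_iff_add_le'] at h1
    linarith
  · rcases le_or_gt (x - μ) 0 with hx | hx
    · have hr0 : r ≤ 0 := by simpa [max_eq_right hx] using hr.le
      refine Eventually.of_forall fun n => le_trans ?_ (htriv r hr0 n)
      have := headSum_nonneg (hA0 n) (Real.exp (h' n + x * n * t n))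
      linarith
    obtain ⟨c, hc, hcx, hcr⟩ := exists_lt_of_lt_sq_max_div hx hr
    filter_upwards [hG.eventually_tail_le hA0 hv ht hc hcr, hh _ (sub_pos.2 hcx)] with n h1 h2
    have h4 := sum_filter_neg_log_le_headSum (hA n) (s := h n + c * (n * t n))
      (K := Real.exp (h' n + x * n * t n)) (Real.exp_le_exp.2 (by
        have := (abs_le.1 h2).2
        linarith))
    have h5 := sum_filter_add_sum_filter_eq_one (hA n) (fun i => -Real.log (A n i))
      (h n + c * (n * t n))
    have h6 : ∑ i ∈ Finset.univ.filter (fun i => -Real.log (A n i) < h n + c * (n * t n)), A n i ≤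
        ∑ i ∈ Finset.univ.filter (fun i => -Real.log (A n i) ≤ h n + c * (n * t n)), A n i :=
      Finset.sum_le_sum_of_subset_of_nonneg
        (Finset.monotone_filter_right _ fun i _ hi => le_of_lt hi) fun i _ _ => hA0 n i
    simp only [le_sub_iff_add_le'] at h1
    linarith

end HeadSums

section Comparison

lemma sq_div_lt_sq_div {u s x y : ℝ} (hu : 0 < u) (hs : 0 < s) (hx : 0 ≤ x) (h : x < s * y) :
    x ^ 2 / (2 * (s ^ 2 * u)) < y ^ 2 / (2 * u) := by
  have h1 : y ^ 2 / (2 * u) = (s * y) ^ 2 / (2 * (s ^ 2 * u)) := by field_simp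
  rw [h1]
  gcongr

lemma sq_div_lt_sq_div' {u s x y : ℝ} (hu : 0 < u) (hs : 0 < s) (hy : 0 ≤ y) (h : s * y < x) :
    y ^ 2 / (2 * u) < x ^ 2 / (2 * (s ^ 2 * u)) := by
  have h1 : y ^ 2 / (2 * u) = (s * y) ^ 2 / (2 * (s ^ 2 * u)) := by field_simp
  rw [h1]
  gcongr

variable {Ω Ω' : ℕ → Type} [∀ n, Fintype (Ω n)] [∀ n, Fintype (Ω' n)]
  {P : ∀ n, Ω n → ℝ} {Q : ∀ n, Ω' n → ℝ} {h t : ℕ → ℝ} {μ μ' v u : ℝ}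

lemma headSum_exp_mono {α : Type*} [Fintype α] {a : α → ℝ} (ha : IsProbDist a) {h n t x y : ℝ}
    (hn : 0 < n) (ht : 0 < t) (hxy : x ≤ y) :
    headSum a (Real.exp (h + x * n * t)) ≤ headSum a (Real.exp (h + y * n * t)) := by
  refine headSum_mono ha.1 (Real.exp_le_exp.2 ?_)
  gcongr

lemma HeadRates.eventually_headSum_le_of_tail (hP : HeadRates P h t μ v)
    (hQ : HeadRates Q h t μ' u) (hP' : ∀ n, IsProbDist (P n)) (hQ' : ∀ n, IsProbDist (Q n))
    (ht : ModerateSeq t) {y : ℝ}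
    (hy : max (y - μ') 0 ^ 2 / (2 * u) < max (μ - y) 0 ^ 2 / (2 * v)) :
    ∀ᶠ n : ℕ in atTop, ∀ x ≤ y, headSum (Q n) (Real.exp (h n + x * n * t n)) ≤
      headSum (P n) (Real.exp (h n + x * n * t n)) +
      (1 - headSum (P n) (Real.exp (h n + y * n * t n))) := by
  obtain ⟨r, hr1, hr2⟩ := exists_between hy
  filter_upwards [hP.head_le y r hr2, hQ.le_tail y r hr1, ht.eventually_pos]
    with n h1 h2 ⟨htn, hn⟩ x hx
  have h3 := headSum_exp_mono (hQ' n) (h := h n) hn htn hx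
  have h4 := headSum_nonneg (hP' n).1 (Real.exp (h n + x * n * t n))
  linarith

lemma HeadRates.eventually_nhds_headSum_le (hP : HeadRates P h t μ v)
    (hQ : HeadRates Q h t μ' u) (hP' : ∀ n, IsProbDist (P n)) (hQ' : ∀ n, IsProbDist (Q n))
    (ht : ModerateSeq t) {x : ℝ}
    (hx : max (μ - x) 0 ^ 2 / (2 * v) < max (μ' - x) 0 ^ 2 / (2 * u) ∨
      max (x - μ') 0 ^ 2 / (2 * u) < max (x - μ) 0 ^ 2 / (2 * v)) :
    ∀ᶠ z : ℕ × ℝ in atTop ×ˢ 𝓝 x,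
      headSum (Q z.1) (Real.exp (h z.1 + z.2 * z.1 * t z.1)) ≤
      headSum (P z.1) (Real.exp (h z.1 + z.2 * z.1 * t z.1)) := by
  obtain ⟨ρ, hρ, hev⟩ : ∃ ρ > 0, ∀ᶠ n : ℕ in atTop,
      headSum (Q n) (Real.exp (h n + (x + ρ) * n * t n)) ≤
      headSum (P n) (Real.exp (h n + (x - ρ) * n * t n)) := by
    rcases hx with hx | hx
    · obtain ⟨r, hr1, hr2⟩ := exists_between hx
      have c1 : ContinuousAt (fun ρ : ℝ => max (μ - (x - ρ)) 0 ^ 2 / (2 * v)) 0 := by fun_prop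
      have c2 : ContinuousAt (fun ρ : ℝ => max (μ' - (x + ρ)) 0 ^ 2 / (2 * u)) 0 := by fun_prop
      have e := ((c1.eventually_lt_const (by simpa using hr1)).and
        (c2.eventually_const_lt (by simpa using hr2))).filter_mono
          (nhdsWithin_le_nhds (s := Set.Ioi 0))
      obtain ⟨ρ, ⟨h1, h2⟩, hρ⟩ := (e.and self_mem_nhdsWithin).exists
      refine ⟨ρ, hρ, ?_⟩
      filter_upwards [hP.le_head _ r h1, hQ.head_le _ r h2] with n k1 k2 using k2.trans k1
    · obtain ⟨r, hr1, hr2⟩ := exists_between hx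
      have c1 : ContinuousAt (fun ρ : ℝ => max (x + ρ - μ') 0 ^ 2 / (2 * u)) 0 := by fun_prop
      have c2 : ContinuousAt (fun ρ : ℝ => max (x - ρ - μ) 0 ^ 2 / (2 * v)) 0 := by fun_prop
      have e := ((c1.eventually_lt_const (by simpa using hr1)).and
        (c2.eventually_const_lt (by simpa using hr2))).filter_mono
          (nhdsWithin_le_nhds (s := Set.Ioi 0))
      obtain ⟨ρ, ⟨h1, h2⟩, hρ⟩ := (e.and self_mem_nhdsWithin).exists
      refine ⟨ρ, hρ, ?_⟩
      filter_upwards [hP.tail_le _ r h2, hQ.le_tail _ r h1] with n k1 k2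
      linarith
  have hx' : ∀ᶠ x' in 𝓝 x, x' ∈ Set.Icc (x - ρ) (x + ρ) :=
    Icc_mem_nhds (by linarith) (by linarith)
  filter_upwards [(hev.and ht.eventually_pos).prod_mk hx'] with z hz
  obtain ⟨⟨h1, htn, hn⟩, h2, h3⟩ := hz
  exact ((headSum_exp_mono (hQ' _) hn htn h3).trans h1).trans
    (headSum_exp_mono (hP' _) hn htn h2)

lemma HeadRates.eventually_headSum_le (hP : HeadRates P h t μ v)
    (hQ : HeadRates Q h t μ' u) (hP' : ∀ n, IsProbDist (P n)) (hQ' : ∀ n, IsProbDist (Q n))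
    (ht : ModerateSeq t) {x₀ y : ℝ}
    (hx₀ : max (y - μ) 0 ^ 2 / (2 * v) < max (μ' - x₀) 0 ^ 2 / (2 * u))
    (hx : ∀ x ∈ Set.Icc x₀ y, max (μ - x) 0 ^ 2 / (2 * v) < max (μ' - x) 0 ^ 2 / (2 * u) ∨
      max (x - μ') 0 ^ 2 / (2 * u) < max (x - μ) 0 ^ 2 / (2 * v)) :
    ∀ᶠ n : ℕ in atTop, ∀ x ≤ y, headSum (Q n) (Real.exp (h n + x * n * t n)) ≤
      headSum (P n) (Real.exp (h n + x * n * t n)) +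
      (1 - headSum (P n) (Real.exp (h n + y * n * t n))) := by
  have hmid : ∀ᶠ n : ℕ in atTop, ∀ x ∈ Set.Icc x₀ y,
      headSum (Q n) (Real.exp (h n + x * n * t n)) ≤
      headSum (P n) (Real.exp (h n + x * n * t n)) := by
    have := isCompact_Icc.mem_prod_nhdsSet_of_forall fun x hxm =>
      hP.eventually_nhds_headSum_le hQ hP' hQ' ht (hx x hxm)
    exact (Filter.Eventually.curry this).mono fun n hn x hxm => hn.self_of_nhdsSet x hxm
  obtain ⟨r, hr1, hr2⟩ := exists_between hx₀
  filter_upwards [hmid, hP.le_tail y r hr1, hQ.head_le x₀ r hr2, ht.eventually_pos]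
    with n h1 h2 h3 ⟨htn, hn⟩ x hxy
  rcases le_total x x₀ with hxx | hxx
  · have h4 := headSum_exp_mono (hQ' n) (h := h n) hn htn hxx
    have h5 := headSum_nonneg (hP' n).1 (Real.exp (h n + x * n * t n))
    linarith
  · have h4 := h1 x ⟨hxx, hxy⟩
    have h5 := headSum_le_one (hP' n) (Real.exp (h n + y * n * t n))
    linarith

end Comparison

lemma nearGaussianMgf_tensor_tpow {d : ℕ} (hd : d ≠ 0) {p : Fin d → ℝ} (hp : IsProbDist p)
    {k : ℕ → ℕ} (l : ℕ → ℕ) {c : ℝ} (hc : 0 < c)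
    (hk : Tendsto (fun n : ℕ => (k n : ℝ) / n) atTop (𝓝 c)) :
    NearGaussianMgf (fun n => tensor (tpow p (k n)) (tpow (unif d) (l n)))
      (fun n i => -Real.log (tensor (tpow p (k n)) (tpow (unif d) (l n)) i) -
        shannonH (tensor (tpow p (k n)) (tpow (unif d) (l n)))) (relV p (unif d) * c) := by
  intro δ hδ
  obtain ⟨l₀, hl₀, hp'⟩ := exists_surprisalMgf_near_gaussian hp
    (show 0 < δ / (2 * c) by positivity)
  refine ⟨l₀, hl₀, ?_⟩
  set V := relV p (unif d)
  have e1 : (V - δ / (2 * c)) * c = V * c - δ / 2 := by field_simp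
  have e2 : (V + δ / (2 * c)) * c = V * c + δ / 2 := by field_simp
  filter_upwards [(hk.const_mul (V - δ / (2 * c))).eventually_const_lt
      (show V * c - δ < _ by rw [e1]; linarith),
    (hk.const_mul (V + δ / (2 * c))).eventually_lt_const
      (show _ < V * c + δ by rw [e2]; linarith), eventually_gt_atTop 0] with n h1 h2 hn x hx
  have hn' : (0 : ℝ) < n := by exact_mod_cast hn
  rw [mul_div_assoc', lt_div_iff₀ hn'] at h1
  rw [mul_div_assoc', div_lt_iff₀ hn'] at h2
  have hη := isProbDist_unif hd
  have hmgf : ∑ i, tensor (tpow p (k n)) (tpow (unif d) (l n)) i * Real.exp (x *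
      (-Real.log (tensor (tpow p (k n)) (tpow (unif d) (l n)) i) -
        shannonH (tensor (tpow p (k n)) (tpow (unif d) (l n))))) =
      surprisalMgf p (shannonH p) x ^ k n := by
    rw [shannonH_tensor (hp.tpow _) (hη.tpow _), shannonH_tpow hp, shannonH_tpow hη,
      shannonH_unif hd]
    have := surprisalMgf_tensor (tpow p (k n)) (tpow (unif d) (l n)) (k n * shannonH p)
      (l n * Real.log d) x
    rwa [surprisalMgf_tpow, surprisalMgf_tpow, surprisalMgf_unif hd, one_pow, mul_one] at this
  obtain ⟨b1, b2⟩ := hp' x hx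
  have hx2 : 0 ≤ x ^ 2 / 2 := by positivity
  rw [hmgf]
  constructor
  · refine le_trans ?_ (pow_le_pow_left₀ (Real.exp_pos _).le b1 _)
    rw [← Real.exp_nat_mul, Real.exp_le_exp]
    nlinarith [mul_le_mul_of_nonneg_right h1.le hx2]
  · refine (pow_le_pow_left₀ ((Real.exp_pos _).le.trans b1) b2 _).trans ?_
    rw [← Real.exp_nat_mul, Real.exp_le_exp]
    nlinarith [mul_le_mul_of_nonneg_right h2.le hx2]

/-- The cut-and-pile modification of the total input distribution eventually majorises
the total output distribution. -/
theorem cut_and_pile_majorisation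
    {d : ℕ} (hd : 2 ≤ d) (p q : Fin d → ℝ) (hp : IsProbDist p) (hq : IsProbDist q)
    (hDp : 0 < relD p (unif d)) (hDq : 0 < relD q (unif d))
    (hVp : 0 < relV p (unif d)) (hVq : 0 < relV q (unif d))
    (t : ℕ → ℝ) (ht : ModerateSeq t)
    (μ : ℝ) (hμ : μ ≠ 0)
    (ν : ℝ)
    (hν : ν = (relV p (unif d) / relD p (unif d)) / (relV q (unif d) / relD q (unif d)))
    (hν1 : μ < 0 → ν ≠ 1)
    (m : ℕ → ℕ)
    (hm : ∀ n : ℕ, m n = ⌊(n : ℝ) * ((relD p (unif d) + μ * t n) / relD q (unif d))⌋₊)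
    (K : ℕ → ℝ → ℝ)
    (hK : ∀ n : ℕ, ∀ x : ℝ, K n x =
      Real.exp (shannonH (tensor (tpow q (m n)) (tpow (unif d) n)) + x * n * t n))
    (z : ℝ)
    (hz1 : μ < 0 → ν < 1 → z = 2 * μ - μ / (1 - Real.sqrt ν))
    (hz2 : μ < 0 → 1 < ν → z = μ / (1 - Real.sqrt ν))
    (hz3 : 0 < μ → z = μ / (1 + Real.sqrt ν)) :
    ∃ ζ₀ > (0 : ℝ), ∀ ζ : ℝ, 0 < ζ → ζ ≤ ζ₀ →
      ∃ N : ℕ, ∀ n ≥ N,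
        Maj (cutAndPile (tensor (tpow p n) (tpow (unif d) (m n))) (K n (z - ζ)))
          (tensor (tpow q (m n)) (tpow (unif d) n)) := by
  have hd0 : d ≠ 0 := by omega
  have hη := isProbDist_unif hd0
  have : Nonempty (Fin d) := ⟨⟨0, by omega⟩⟩
  set Dp := relD p (unif d)
  set Dq := relD q (unif d)
  have hDp' : Dp = Real.log d - shannonH p := relD_unif hp
  have hDq' : Dq = Real.log d - shannonH q := relD_unif hq
  have hP : ∀ n, IsProbDist (tensor (tpow p n) (tpow (unif d) (m n))) := fun n =>
    (hp.tpow n).tensor (hη.tpow (m n))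
  have hQ : ∀ n, IsProbDist (tensor (tpow q (m n)) (tpow (unif d) n)) := fun n =>
    (hq.tpow (m n)).tensor (hη.tpow n)
  set h : ℕ → ℝ := fun n => shannonH (tensor (tpow q (m n)) (tpow (unif d) n)) with hhdef
  have hr : Tendsto (fun n => (Dp + μ * t n) / Dq) atTop (𝓝 (Dp / Dq)) := by
    simpa using ((ht.1.const_mul μ).const_add Dp).div_const Dq
  have hfloor : ∀ᶠ n : ℕ in atTop, |(m n : ℝ) - n * ((Dp + μ * t n) / Dq)| ≤ 1 := by
    filter_upwards [hr.eventually_const_lt (div_pos hDp hDq)] with n hn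
    rw [hm n]
    have h0 : 0 ≤ (n : ℝ) * ((Dp + μ * t n) / Dq) := by positivity
    have h1 := Nat.floor_le h0
    have h2 := Nat.lt_floor_add_one ((n : ℝ) * ((Dp + μ * t n) / Dq))
    exact abs_le.2 ⟨by linarith, by linarith⟩
  have hmn : Tendsto (fun n : ℕ => (m n : ℝ) / n) atTop (𝓝 (Dp / Dq)) := by
    have h0 : Tendsto (fun n : ℕ => (m n : ℝ) / n - (Dp + μ * t n) / Dq) atTop (𝓝 0) := by
      refine squeeze_zero_norm' ?_ tendsto_one_div_atTop_nhds_zero_nat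
      filter_upwards [hfloor, eventually_gt_atTop 0] with n hn hn0
      have hn0' : (0 : ℝ) < n := by exact_mod_cast hn0
      rw [Real.norm_eq_abs, le_div_iff₀ hn0', ← abs_of_pos hn0', ← abs_mul, abs_of_pos hn0']
      refine le_trans (le_of_eq ?_) hn
      congr 1
      field_simp
    simpa using h0.add hr
  have hone : Tendsto (fun n : ℕ => (n : ℝ) / n) atTop (𝓝 1) :=
    tendsto_const_nhds.congr' <| (eventually_gt_atTop 0).mono fun n hn =>
      (div_self (by exact_mod_cast hn.ne')).symm
  have hPrate : HeadRates (fun n => tensor (tpow p n) (tpow (unif d) (m n))) h t μ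
      (relV p (unif d)) := by
    have hG := nearGaussianMgf_tensor_tpow hd0 hp m one_pos hone
    rw [mul_one] at hG
    refine hG.headRates hP ht hVp fun ε hε => ?_
    filter_upwards [hfloor, (ht.tendsto_mul.const_mul_atTop hε).eventually_ge_atTop Dq]
      with n h1 h2
    have : shannonH (tensor (tpow p n) (tpow (unif d) (m n))) - h n - μ * n * t n =
        Dq * (m n - n * ((Dp + μ * t n) / Dq)) := by
      rw [hhdef, shannonH_tensor (hp.tpow n) (hη.tpow (m n)), shannonH_tpow hp, shannonH_tpow hη]
      simp only
      rw [shannonH_tensor (hq.tpow (m n)) (hη.tpow n), shannonH_tpow hq, shannonH_tpow hη,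
        shannonH_unif hd0]
      have e : Dq * (m n - n * ((Dp + μ * t n) / Dq)) = Dq * m n - n * (Dp + μ * t n) := by
        field_simp
      rw [e, hDp', hDq']
      ring
    rw [this, abs_mul, abs_of_pos hDq]
    exact (mul_le_of_le_one_right hDq.le h1).trans h2
  set u := relV q (unif d) * (Dp / Dq) with hu
  have hu0 : 0 < u := by positivity
  have hQrate : HeadRates (fun n => tensor (tpow q (m n)) (tpow (unif d) n)) h t 0 u := by
    have hG := nearGaussianMgf_tensor_tpow hd0 hq (fun n => n) (div_pos hDp hDq) hmn
    refine hG.headRates hQ ht hu0 fun ε hε => ?_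
    filter_upwards [ht.eventually_pos] with n ⟨htn, hn⟩
    simp only [hhdef, sub_self, zero_mul, abs_zero]
    positivity
  have hν0 : 0 < ν := by rw [hν]; positivity
  set s := √ν with hs
  have hs0 : 0 < s := Real.sqrt_pos.2 hν0
  have hvu : relV p (unif d) = s ^ 2 * u := by
    rw [hs, Real.sq_sqrt hν0.le, hν, hu]
    field_simp
  refine ⟨1, one_pos, fun ζ hζ _ => ?_⟩
  have hmain : ∀ᶠ n : ℕ in atTop, ∀ x ≤ z - ζ,
      headSum (tensor (tpow q (m n)) (tpow (unif d) n)) (Real.exp (h n + x * n * t n)) ≤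
      headSum (tensor (tpow p n) (tpow (unif d) (m n))) (Real.exp (h n + x * n * t n)) +
      (1 - headSum (tensor (tpow p n) (tpow (unif d) (m n)))
        (Real.exp (h n + (z - ζ) * n * t n))) := by
    rcases lt_or_gt_of_ne hμ with hμ' | hμ'
    · have hνs : ν = s ^ 2 := (Real.sq_sqrt hν0.le).symm
      rcases lt_or_gt_of_ne (hν1 hμ') with hν' | hν'
      · have hs1 : s < 1 := by nlinarith
        have hz := hz1 hμ' hν'
        set zc := μ / (1 - s) with hzc
        have hμzc : μ = zc * (1 - s) := by
          rw [hzc, div_mul_cancel₀ _ (by linarith)]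
        have hzc0 : zc < 0 := div_neg_of_neg_of_pos hμ' (by linarith)
        obtain ⟨ξ, hξ, hξζ, hξz⟩ : ∃ ξ > 0, ξ < ζ ∧ zc + ξ < 0 := by
          obtain ⟨ξ, h1, h2⟩ := exists_between (lt_min hζ (neg_pos.2 hzc0))
          exact ⟨ξ, h1, h2.trans_le (min_le_left _ _), by linarith [min_le_right ζ (-zc)]⟩
        refine hPrate.eventually_headSum_le hQrate hP hQ ht (x₀ := zc + ξ) ?_ fun x hx => ?_
        · rw [hvu]
          refine sq_div_lt_sq_div hu0 hs0 (le_max_right _ _) ?_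
          rw [max_eq_left (by linarith : 0 ≤ 0 - (zc + ξ))]
          refine max_lt ?_ (by nlinarith)
          nlinarith
        · have hx1 := hx.1
          rcases lt_or_ge x 0 with hx0 | hx0
          · left
            rw [hvu]
            refine sq_div_lt_sq_div hu0 hs0 (le_max_right _ _) ?_
            rw [max_eq_left (by linarith : 0 ≤ 0 - x)]
            refine max_lt ?_ (by nlinarith)
            nlinarith
          · right
            rw [hvu]
            refine sq_div_lt_sq_div' hu0 hs0 (le_max_right _ _) ?_
            rw [max_eq_left (by linarith : 0 ≤ x - 0)]
            refine lt_max_of_lt_left ?_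
            nlinarith
      · have hs1 : 1 < s := by nlinarith
        have hz := hz2 hμ' hν'
        have hμz : μ = z * (1 - s) := by
          rw [hz, div_mul_cancel₀ _ (by linarith)]
        refine hPrate.eventually_headSum_le hQrate hP hQ ht
          (x₀ := min (-1) (-(|z - ζ - μ| + 1) / s)) ?_ fun x hx => ?_
        · rw [hvu]
          refine sq_div_lt_sq_div hu0 hs0 (le_max_right _ _) ?_
          refine lt_of_lt_of_le ?_ (mul_le_mul_of_nonneg_left (le_max_left _ _) hs0.le)
          have h1 := min_le_right (-1) (-(|z - ζ - μ| + 1) / s)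
          have h2 : s * (-(|z - ζ - μ| + 1) / s) = -(|z - ζ - μ| + 1) := by field_simp
          have h3 := mul_le_mul_of_nonneg_left h1 hs0.le
          rw [h2] at h3
          have h4 := le_abs_self (z - ζ - μ)
          have h5 := abs_nonneg (z - ζ - μ)
          exact max_lt (by linarith) (by linarith)
        · have hx2 := hx.2
          rcases lt_or_ge x 0 with hx0 | hx0
          · left
            rw [hvu]
            refine sq_div_lt_sq_div hu0 hs0 (le_max_right _ _) ?_
            rw [max_eq_left (by linarith : 0 ≤ 0 - x)]
            refine max_lt ?_ (by nlinarith)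
            nlinarith
          · right
            rw [hvu]
            refine sq_div_lt_sq_div' hu0 hs0 (le_max_right _ _) ?_
            rw [max_eq_left (by linarith : 0 ≤ x - 0)]
            refine lt_max_of_lt_left ?_
            nlinarith
    · refine hPrate.eventually_headSum_le_of_tail hQrate hP hQ ht ?_
      have hz := hz3 hμ'
      have hμz : μ = z * (1 + s) := by
        rw [hz, div_mul_cancel₀ _ (by linarith)]
      have hz0 : 0 < z := by rw [hz]; positivity
      rw [hvu]
      refine sq_div_lt_sq_div' hu0 hs0 (le_max_right _ _) ?_
      refine lt_max_of_lt_left ?_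
      rw [mul_max_of_nonneg _ _ hs0.le]
      exact max_lt (by nlinarith) (by nlinarith)
  obtain ⟨N, hN⟩ := eventually_atTop.1 (hmain.and ht.eventually_pos)
  refine ⟨N, fun n hn => cutAndPile_maj (hP n) (hQ n) fun j hj hjK => ?_⟩
  obtain ⟨hn1, htn, hn0⟩ := hN n hn
  have hw : 0 < (n : ℝ) * t n := mul_pos hn0 htn
  have hj0 : (0 : ℝ) < j := by exact_mod_cast hj
  rw [hK] at hjK ⊢
  have hlog := (Real.log_lt_iff_lt_exp hj0).2 hjK
  have hx : h n + (Real.log j - h n) / (n * t n) * n * t n = Real.log j := by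
    field_simp
    ring
  have := hn1 ((Real.log j - h n) / (n * t n)) (by
    rw [div_le_iff₀ hw]
    linarith)
  rwa [hx, Real.exp_log hj0] at this
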